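/- If 0 < α < β/(1+β) < β < 1, then the Hausdorff dimension of E(α,β) is at most s(β²(1−α)/((1−β)(β−α(1+β)))). -/

import Mathlib

open Filter MeasureTheory Set

/-- The Lüroth transformation on (0,1]. -/
noncomputable def lurothT (x : ℝ) : ℝ :=
  (⌊1/x⌋ : ℝ) * ((⌊1/x⌋ : ℝ) + 1) * (x - 1/((⌊1/x⌋ : ℝ) + 1))

/-- The n-th Lüroth digit (n ≥ 1): d₁(x) = ⌊1/x⌋ + 1, dₙ(x) = d₁(T^[n-1] x). -/
noncomputable def lurothD (n : ℕ) (x : ℝ) : ℕ :=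
  (⌊1 / (lurothT^[n-1] x)⌋ + 1).toNat

/-- The n-th maximal run-length function. -/
noncomputable def runLen (n : ℕ) (x : ℝ) : ℕ :=
  sSup {k : ℕ | 1 ≤ k ∧ ∃ j : ℕ, j + k ≤ n ∧
    ∀ i : ℕ, 1 ≤ i → i ≤ k → lurothD (j + i) x = lurothD (j + 1) x}

/-- The level set E(α,β). -/
noncomputable def Eab (a b : ℝ) : Set ℝ :=
  {x | x ∈ Set.Ioc (0:ℝ) 1 ∧
    Filter.liminf (fun n : ℕ => (runLen n x : ℝ) / n) Filter.atTop = a ∧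
    Filter.limsup (fun n : ℕ => (runLen n x : ℝ) / n) Filter.atTop = b}

/-- The series ∑_{t=2}^∞ (1/(2^u t(t-1)))^s. -/
noncomputable def lurothF (u s : ℝ) : ℝ :=
  ∑' t : ℕ, (1 / (2 ^ u * ((t : ℝ) + 2) * ((t : ℝ) + 1))) ^ s

/-- The inverse branch of the Lüroth map on the cylinder of points with first digit `t + 2`. -/
noncomputable def lurothBranch (t : ℕ) (y : ℝ) : ℝ :=
  ((t : ℝ) + 2)⁻¹ * ((t : ℝ) + 1)⁻¹ * y + ((t : ℝ) + 2)⁻¹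

theorem exists_lurothBranch {x : ℝ} (hx : x ∈ Ioc (0 : ℝ) 1) :
    ∃ t : ℕ, lurothD 1 x = t + 2 ∧ x = lurothBranch t (lurothT x) ∧ lurothT x ∈ Ioc (0 : ℝ) 1 := by
  obtain ⟨h0, h1⟩ := hx
  have hf : (1 : ℤ) ≤ ⌊1 / x⌋ := by
    rw [Int.le_floor]
    simpa using (one_le_one_div h0 h1)
  obtain ⟨t, ht⟩ : ∃ t : ℕ, ⌊1 / x⌋ = (t : ℤ) + 1 := ⟨(⌊1 / x⌋ - 1).toNat, by omega⟩
  have htr : (⌊1 / x⌋ : ℝ) = (t : ℝ) + 1 := by exact_mod_cast ht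
  have hle := Int.floor_le (1 / x)
  have hlt := Int.lt_floor_add_one (1 / x)
  rw [htr] at hle hlt
  rw [le_div_iff₀ h0] at hle
  rw [div_lt_iff₀ h0] at hlt
  have ht0 : (0 : ℝ) ≤ t := Nat.cast_nonneg t
  have hT : lurothT x = ((t : ℝ) + 1) * (((t : ℝ) + 2) * x - 1) := by
    rw [lurothT, htr]
    field_simp
    ring
  refine ⟨t, ?_, ?_, ?_, ?_⟩
  · simp only [lurothD, Nat.sub_self, Function.iterate_zero, id]
    omega
  · rw [hT, lurothBranch]
    field_simp
    ring
  · rw [hT]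
    apply mul_pos <;> linarith
  · rw [hT]
    nlinarith

theorem iterate_lurothT_mem {x : ℝ} (hx : x ∈ Ioc (0 : ℝ) 1) (n : ℕ) :
    lurothT^[n] x ∈ Ioc (0 : ℝ) 1 := by
  induction n with
  | zero => exact hx
  | succ n ih =>
    rw [Function.iterate_succ_apply']
    obtain ⟨t, -, -, h⟩ := exists_lurothBranch ih
    exact h

theorem lurothD_iterate (n m : ℕ) (x : ℝ) :
    lurothD (n + 1) (lurothT^[m] x) = lurothD (m + n + 1) x := by
  simp only [lurothD, Nat.add_sub_cancel, ← Function.iterate_add_apply, Nat.add_comm n m]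

theorem eq_iterate_lurothBranch {t n : ℕ} {x : ℝ} (hx : x ∈ Ioc (0 : ℝ) 1)
    (h : ∀ i < n, lurothD (i + 1) x = t + 2) : x = (lurothBranch t)^[n] (lurothT^[n] x) := by
  induction n generalizing x with
  | zero => rfl
  | succ n ih =>
    obtain ⟨t', h1, h2, h3⟩ := exists_lurothBranch hx
    obtain rfl : t' = t := by
      have := h 0 (Nat.succ_pos n)
      rw [Nat.zero_add] at this
      omega
    have := ih h3 fun i hi => by
      have h4 := lurothD_iterate i 1 x
      rw [Function.iterate_one] at h4
      rw [h4, Nat.add_comm 1 i]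
      exact h (i + 1) (by omega)
    rw [Function.iterate_succ_apply', Function.iterate_succ_apply, ← this, ← h2]

/-- The digits of `x` in positions `j + 1, …, j + L` agree. -/
def IsRun (x : ℝ) (j L : ℕ) : Prop :=
  ∀ i < L, lurothD (j + i + 1) x = lurothD (j + 1) x

/-- The first `n` digits of `x` contain `K` successive disjoint runs of total length `M`. -/
def HasRuns (x : ℝ) : ℕ → ℕ → ℕ → Prop
  | 0, M, _ => M = 0
  | K + 1, M, n => ∃ j L M', M = M' + L ∧ 1 ≤ L ∧ j + L ≤ n ∧ IsRun x j L ∧ HasRuns x K M' j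

section Cover

open scoped NNReal ENNReal

variable {h : OuterMeasure ℝ} {g : ℕ → ℝ≥0} {F γ C : ℝ≥0}

theorem outer_iterate_branch_le (hg : ∀ t A, h (lurothBranch t '' A) ≤ g t * h A)
    (t n : ℕ) (A : Set ℝ) : h ((lurothBranch t)^[n] '' A) ≤ (g t : ℝ≥0∞) ^ n * h A := by
  induction n generalizing A with
  | zero => simp
  | succ n ih =>
    rw [Function.iterate_succ, image_comp]
    calc _ ≤ (g t : ℝ≥0∞) ^ n * h (lurothBranch t '' A) := ih _
      _ ≤ (g t : ℝ≥0∞) ^ n * (g t * h A) := by gcongr; exact hg t A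
      _ = _ := by ring

theorem outer_run_le (hg : ∀ t A, h (lurothBranch t '' A) ≤ g t * h A)
    (hF : ∑' t, (g t : ℝ≥0∞) = F) (hγ : ∀ t, g t ≤ F * γ) (hC : C * γ = 1) {L : ℕ} (hL : 1 ≤ L)
    (A : Set ℝ) :
    h {x | x ∈ Ioc (0 : ℝ) 1 ∧ IsRun x 0 L ∧ lurothT^[L] x ∈ A} ≤ C * F ^ L * γ ^ L * h A := by
  have hsub : {x | x ∈ Ioc (0 : ℝ) 1 ∧ IsRun x 0 L ∧ lurothT^[L] x ∈ A} ⊆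
      ⋃ t : ℕ, (lurothBranch t)^[L] '' A := by
    rintro x ⟨hx, hr, hA⟩
    obtain ⟨t, ht, -⟩ := exists_lurothBranch hx
    refine mem_iUnion.2 ⟨t, _, hA, (eq_iterate_lurothBranch hx fun i hi => ?_).symm⟩
    simpa [ht] using hr i hi
  obtain ⟨l, rfl⟩ : ∃ l, L = l + 1 := ⟨L - 1, by omega⟩
  calc _ ≤ h (⋃ t : ℕ, (lurothBranch t)^[l + 1] '' A) := h.mono hsub
    _ ≤ ∑' t : ℕ, h ((lurothBranch t)^[l + 1] '' A) := measure_iUnion_le _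
    _ ≤ ∑' t : ℕ, (g t : ℝ≥0∞) * (((F * γ : ℝ≥0) : ℝ≥0∞) ^ l * h A) := by
      refine ENNReal.tsum_le_tsum fun t => (outer_iterate_branch_le hg t _ A).trans ?_
      rw [pow_succ', mul_assoc]
      gcongr
      exact hγ t
    _ = C * γ * (F * (((F * γ : ℝ≥0) : ℝ≥0∞) ^ l * h A)) := by
      rw [ENNReal.tsum_mul_right, hF, ← ENNReal.coe_mul, hC, ENNReal.coe_one, one_mul]
    _ = _ := by push_cast; ring

theorem outer_free_le (hg : ∀ t A, h (lurothBranch t '' A) ≤ g t * h A)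
    (hF : ∑' t, (g t : ℝ≥0∞) = F) (n : ℕ) (A : Set ℝ) :
    h {x | x ∈ Ioc (0 : ℝ) 1 ∧ lurothT^[n] x ∈ A} ≤ (F : ℝ≥0∞) ^ n * h A := by
  induction n generalizing A with
  | zero => simpa using h.mono fun x hx => hx.2
  | succ n ih =>
    have hsub : {x | x ∈ Ioc (0 : ℝ) 1 ∧ lurothT^[n + 1] x ∈ A} ⊆
        ⋃ t : ℕ, lurothBranch t '' {x | x ∈ Ioc (0 : ℝ) 1 ∧ lurothT^[n] x ∈ A} := by
      rintro x ⟨hx, hA⟩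
      obtain ⟨t, -, h1, h2⟩ := exists_lurothBranch hx
      exact mem_iUnion.2 ⟨t, _, ⟨h2, by rwa [← Function.iterate_succ_apply]⟩, h1.symm⟩
    calc _ ≤ _ := h.mono hsub
      _ ≤ ∑' t : ℕ, h (lurothBranch t '' {x | x ∈ Ioc (0 : ℝ) 1 ∧ lurothT^[n] x ∈ A}) :=
        measure_iUnion_le _
      _ ≤ ∑' t : ℕ, (g t : ℝ≥0∞) * (F ^ n * h A) :=
        ENNReal.tsum_le_tsum fun t => (hg t _).trans (by gcongr; exact ih A)
      _ = _ := by rw [ENNReal.tsum_mul_right, hF]; ring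

theorem isRun_iterate {x : ℝ} {j L : ℕ} : IsRun (lurothT^[j] x) 0 L ↔ IsRun x j L := by
  have h0 := lurothD_iterate 0 j x
  simp only [IsRun, Nat.zero_add, lurothD_iterate] at h0 ⊢

theorem outer_hasRuns_le (hg : ∀ t A, h (lurothBranch t '' A) ≤ g t * h A)
    (hF : ∑' t, (g t : ℝ≥0∞) = F) (hγ : ∀ t, g t ≤ F * γ) (hC : C * γ = 1) (K M n : ℕ)
    (A : Set ℝ) :
    h {x | x ∈ Ioc (0 : ℝ) 1 ∧ HasRuns x K M n ∧ lurothT^[n] x ∈ A} ≤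
      (((n : ℝ≥0∞) + 1) ^ 2 * C) ^ K * F ^ n * γ ^ M * h A := by
  induction K generalizing M n A with
  | zero =>
    by_cases hM : M = 0
    · subst hM
      simpa [HasRuns] using outer_free_le hg hF n A
    · simp [HasRuns, hM]
  | succ K ih =>
    let B : ℕ → ℕ → Set ℝ := fun j L =>
      {y | y ∈ Ioc (0 : ℝ) 1 ∧ IsRun y 0 L ∧
        lurothT^[L] y ∈ {z | z ∈ Ioc (0 : ℝ) 1 ∧ lurothT^[n - (j + L)] z ∈ A}}
    let P := ((Finset.range (n + 1)) ×ˢ (Finset.range (n + 1))).filter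
      fun p => 1 ≤ p.2 ∧ p.2 ≤ M ∧ p.1 + p.2 ≤ n
    have hsub : {x | x ∈ Ioc (0 : ℝ) 1 ∧ HasRuns x (K + 1) M n ∧ lurothT^[n] x ∈ A} ⊆
        ⋃ p ∈ P, {x | x ∈ Ioc (0 : ℝ) 1 ∧ HasRuns x K (M - p.2) p.1 ∧
          lurothT^[p.1] x ∈ B p.1 p.2} := by
      rintro x ⟨hx, ⟨j, L, M', hM, hL, hjL, hr, hK⟩, hA⟩
      refine mem_iUnion₂.2 ⟨(j, L), ?_, hx, ?_, iterate_lurothT_mem hx _, isRun_iterate.2 hr, ?_, ?_⟩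
      · simp only [P, Finset.mem_filter, Finset.mem_product, Finset.mem_range]
        omega
      · rwa [show M - L = M' by omega]
      · exact iterate_lurothT_mem (iterate_lurothT_mem hx _) _
      · rw [← Function.iterate_add_apply, ← Function.iterate_add_apply]
        convert hA using 2
        dsimp only
        omega
    have hP : ∀ p ∈ P, h {x | x ∈ Ioc (0 : ℝ) 1 ∧ HasRuns x K (M - p.2) p.1 ∧
          lurothT^[p.1] x ∈ B p.1 p.2} ≤
        (((n : ℝ≥0∞) + 1) ^ 2 * C) ^ K * C * F ^ n * γ ^ M * h A := by
      rintro ⟨j, L⟩ hp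
      simp only [P, Finset.mem_filter, Finset.mem_product, Finset.mem_range] at hp
      have e1 : (F : ℝ≥0∞) ^ n = F ^ j * F ^ L * F ^ (n - (j + L)) := by
        rw [← pow_add, ← pow_add]; congr 1; omega
      have e2 : (γ : ℝ≥0∞) ^ M = γ ^ (M - L) * γ ^ L := by
        rw [← pow_add]; congr 1; omega
      calc _ ≤ (((j : ℝ≥0∞) + 1) ^ 2 * C) ^ K * F ^ j * γ ^ (M - L) * h (B j L) := ih _ _ _
        _ ≤ (((n : ℝ≥0∞) + 1) ^ 2 * C) ^ K * F ^ j * γ ^ (M - L) *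
            (C * F ^ L * γ ^ L * (F ^ (n - (j + L)) * h A)) := by
          gcongr
          · omega
          · exact (outer_run_le hg hF hγ hC hp.2.1 _).trans (by gcongr; exact outer_free_le hg hF _ A)
        _ = _ := by rw [e1, e2]; ring
    calc _ ≤ _ := h.mono hsub
      _ ≤ ∑ p ∈ P, h {x | x ∈ Ioc (0 : ℝ) 1 ∧ HasRuns x K (M - p.2) p.1 ∧
          lurothT^[p.1] x ∈ B p.1 p.2} := measure_biUnion_finset_le _ _
      _ ≤ ∑ p ∈ P, (((n : ℝ≥0∞) + 1) ^ 2 * C) ^ K * C * F ^ n * γ ^ M * h A :=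
        Finset.sum_le_sum hP
      _ = P.card * ((((n : ℝ≥0∞) + 1) ^ 2 * C) ^ K * C * F ^ n * γ ^ M * h A) := by
        rw [Finset.sum_const, nsmul_eq_mul]
      _ ≤ ((n : ℝ≥0∞) + 1) ^ 2 *
          ((((n : ℝ≥0∞) + 1) ^ 2 * C) ^ K * C * F ^ n * γ ^ M * h A) := by
        gcongr
        have : P.card ≤ (n + 1) ^ 2 := (Finset.card_filter_le _ _).trans (by simp [sq])
        exact_mod_cast this
      _ = _ := by ring

end Cover

section Dimension

open scoped NNReal ENNReal

theorem HasRuns.le {x : ℝ} {K M n : ℕ} (h : HasRuns x K M n) : M ≤ n := by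
  induction K generalizing M n with
  | zero => exact (show M = 0 from h) ▸ Nat.zero_le n
  | succ K ih =>
    obtain ⟨j, L, M', rfl, -, h1, -, h2⟩ := h
    have := ih h2
    omega

/-- The size to the power `s` of the cylinder of points with first digit `t + 2`. -/
noncomputable def branchWeight (s : ℝ≥0) (t : ℕ) : ℝ≥0 :=
  (((t : ℝ≥0) + 2)⁻¹ * ((t : ℝ≥0) + 1)⁻¹) ^ (s : ℝ)

theorem branchWeight_pos (s : ℝ≥0) (t : ℕ) : 0 < branchWeight s t :=
  NNReal.rpow_pos (by positivity)

theorem branchWeight_le (s : ℝ≥0) (t : ℕ) : branchWeight s t ≤ branchWeight s 0 := by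
  unfold branchWeight
  gcongr <;> simp

theorem pre_branch_le (s : ℝ≥0) (r : ℝ≥0∞) (t : ℕ) (A : Set ℝ) :
    OuterMeasure.mkMetric'.pre (fun B : Set ℝ => Metric.ediam B ^ (s : ℝ)) r (lurothBranch t '' A) ≤
      branchWeight s t *
        OuterMeasure.mkMetric'.pre (fun B : Set ℝ => Metric.ediam B ^ (s : ℝ)) r A := by
  set μ := OuterMeasure.mkMetric'.pre (fun B : Set ℝ => Metric.ediam B ^ (s : ℝ)) r
  set k : ℝ≥0 := ((t : ℝ≥0) + 2)⁻¹ * ((t : ℝ≥0) + 1)⁻¹ with hk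
  have hk1 : k ≤ 1 := mul_le_one₀ (inv_le_one_of_one_le₀ (by
    rw [← one_add_one_eq_two, ← add_assoc]; exact le_add_self)) zero_le
    (inv_le_one_of_one_le₀ le_add_self)
  have hlip : LipschitzWith k (lurothBranch t) := by
    refine LipschitzWith.of_dist_le_mul fun x y => le_of_eq ?_
    have : ((k : ℝ≥0) : ℝ) = ((t : ℝ) + 2)⁻¹ * ((t : ℝ) + 1)⁻¹ := by simp [hk]
    rw [this, Real.dist_eq, Real.dist_eq, lurothBranch, lurothBranch, add_sub_add_right_eq_sub,
      ← mul_sub, abs_mul, abs_of_pos (by positivity)]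
  have hw0 : (branchWeight s t : ℝ≥0∞) ≠ 0 := by simpa using (branchWeight_pos s t).ne'
  have hle : (branchWeight s t : ℝ≥0∞)⁻¹ • OuterMeasure.comap (lurothBranch t) μ ≤ μ := by
    refine OuterMeasure.mkMetric'.le_pre.2 fun B hB => ?_
    have hd := hlip.ediam_image_le B
    have hd1 : Metric.ediam (lurothBranch t '' B) ≤ r :=
      hd.trans ((mul_le_of_le_one_left zero_le (by exact_mod_cast hk1)).trans hB)
    rw [smul_apply, OuterMeasure.comap_apply, smul_eq_mul, mul_comm,
      ← div_eq_mul_inv]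
    refine ENNReal.div_le_of_le_mul' ((OuterMeasure.mkMetric'.pre_le hd1).trans ?_)
    calc _ ≤ (k * Metric.ediam B) ^ (s : ℝ) := by gcongr
      _ = _ := by
        rw [ENNReal.mul_rpow_of_nonneg _ _ s.coe_nonneg, branchWeight, ← hk,
          ENNReal.coe_rpow_of_nonneg _ s.coe_nonneg]
  have := hle A
  rw [smul_apply, OuterMeasure.comap_apply, smul_eq_mul, mul_comm,
    ← div_eq_mul_inv] at this
  rwa [ENNReal.div_le_iff hw0 ENNReal.coe_ne_top, mul_comm] at this

theorem pre_Ioc_ne_top (s : ℝ≥0) {r : ℝ≥0∞} (hr : 0 < r) :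
    OuterMeasure.mkMetric'.pre (fun B : Set ℝ => Metric.ediam B ^ (s : ℝ)) r (Ioc 0 1) ≠ ∞ := by
  set μ := OuterMeasure.mkMetric'.pre (fun B : Set ℝ => Metric.ediam B ^ (s : ℝ)) r
  have : μ (Icc 0 1) < ∞ := by
    refine isCompact_Icc.induction_on (p := fun A => μ A < ∞) (by simp)
      (fun A B hAB hB => (μ.mono hAB).trans_lt hB)
      (fun A B hA hB => (measure_union_le A B).trans_lt (ENNReal.add_lt_top.2 ⟨hA, hB⟩))
      fun x _ => ?_
    obtain ⟨ε, hε0, hε⟩ : ∃ ε : ℝ≥0, 0 < ε ∧ (2 : ℝ≥0∞) * ε ≤ r := by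
      obtain ⟨ε, h0, h1⟩ := ENNReal.lt_iff_exists_nnreal_btwn.1 (ENNReal.half_pos hr.ne')
      refine ⟨ε, by simpa using h0, ?_⟩
      rw [mul_comm]
      exact (ENNReal.le_div_iff_mul_le (by simp) (by simp)).1 h1.le
    refine ⟨Metric.eball x ε, mem_nhdsWithin_of_mem_nhds
      (Metric.eball_mem_nhds x (by simpa using hε0)), ?_⟩
    have hd : Metric.ediam (Metric.eball x ε) ≤ 2 * ε := Metric.ediam_eball_le
    refine (OuterMeasure.mkMetric'.pre_le (hd.trans hε)).trans_lt
      (ENNReal.rpow_lt_top_of_nonneg s.coe_nonneg (ne_top_of_le_ne_top ?_ hd))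
    exact ENNReal.mul_ne_top (by simp) ENNReal.coe_ne_top
  exact ((μ.mono Ioc_subset_Icc_self).trans_lt this).ne

theorem dimH_le_of_frequently_hasRuns {s : ℝ≥0} {E : Set ℝ} {K : ℕ} {θ : ℝ}
    (hsum : Summable (branchWeight s))
    (hlt : (∑' t, branchWeight s t) *
      (branchWeight s 0 / ∑' t, branchWeight s t) ^ θ < 1)
    (hE : ∀ x ∈ E, x ∈ Ioc (0 : ℝ) 1 ∧ ∃ᶠ n : ℕ in atTop, ∃ M : ℕ, θ * n ≤ M ∧ HasRuns x K M n) :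
    dimH E ≤ s := by
  set F := ∑' t, branchWeight s t with hF
  set γ := branchWeight s 0 / F with hγ
  have hg0 := branchWeight_pos s 0
  have hgF : branchWeight s 0 ≤ F := hsum.le_tsum 0 fun _ _ => zero_le
  have hF0 : 0 < F := hg0.trans_le hgF
  have hγ0 : 0 < γ := div_pos hg0 hF0
  have hγ1 : γ ≤ 1 := div_le_one_of_le₀ hgF zero_le
  set q := F * γ ^ θ with hq
  have hq0 : 0 < q := mul_pos hF0 (NNReal.rpow_pos hγ0)
  have hsumq : Summable fun n : ℕ => ((n : ℝ≥0) + 1) ^ (2 * K + 1) * q ^ n := by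
    rw [← NNReal.summable_coe]
    have h1 := summable_pow_mul_geometric_of_norm_lt_one (R := ℝ) (2 * K + 1) (r := q) (by
      rw [Real.norm_of_nonneg q.coe_nonneg]; exact_mod_cast hlt)
    have h2 := ((summable_nat_add_iff 1).2 h1).mul_right ((q : ℝ)⁻¹)
    refine h2.congr fun n => ?_
    have : (q : ℝ) ≠ 0 := by exact_mod_cast hq0.ne'
    push_cast
    field_simp
    ring
  borelize ℝ
  refine dimH_le_of_hausdorffMeasure_ne_top (d := s) ?_
  suffices h0 : Measure.hausdorffMeasure (s : ℝ) E = 0 by rw [h0]; exact ENNReal.zero_ne_top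
  rw [Measure.hausdorffMeasure, ← OuterMeasure.coe_mkMetric, OuterMeasure.mkMetric,
    OuterMeasure.mkMetric']
  simp only [OuterMeasure.iSup_apply, ENNReal.iSup_eq_zero]
  intro r hr
  set h := OuterMeasure.mkMetric'.pre (fun B : Set ℝ => Metric.ediam B ^ (s : ℝ)) r with hh
  let V : ℕ → Set ℝ := fun n =>
    {x | x ∈ Ioc (0 : ℝ) 1 ∧ ∃ M : ℕ, θ * n ≤ M ∧ HasRuns x K M n}
  have hV : ∀ n : ℕ, h (V n) ≤
      (((n : ℝ≥0) + 1) ^ (2 * K + 1) * q ^ n : ℝ≥0) * (((γ⁻¹ : ℝ≥0) : ℝ≥0∞) ^ K * h (Ioc 0 1)) := by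
    intro n
    let P := (Finset.range (n + 1)).filter fun M : ℕ => θ * n ≤ M
    have hsub : V n ⊆ ⋃ M ∈ P,
        {x | x ∈ Ioc (0 : ℝ) 1 ∧ HasRuns x K M n ∧ lurothT^[n] x ∈ Ioc (0 : ℝ) 1} := by
      rintro x ⟨hx, M, hM, hR⟩
      refine mem_iUnion₂.2 ⟨M, ?_, hx, hR, iterate_lurothT_mem hx n⟩
      have := hR.le
      simp only [P, Finset.mem_filter, Finset.mem_range]
      exact ⟨by omega, hM⟩
    have hP : ∀ M ∈ P,
        h {x | x ∈ Ioc (0 : ℝ) 1 ∧ HasRuns x K M n ∧ lurothT^[n] x ∈ Ioc (0 : ℝ) 1} ≤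
        (((n : ℝ≥0∞) + 1) ^ 2 * (γ⁻¹ : ℝ≥0)) ^ K * (q : ℝ≥0∞) ^ n * h (Ioc 0 1) := by
      intro M hM
      refine (outer_hasRuns_le (γ := γ) (C := γ⁻¹) (pre_branch_le s r)
        (ENNReal.coe_tsum hsum).symm (fun t => ?_) (inv_mul_cancel₀ hγ0.ne') K M n _).trans ?_
      · rw [← hF, hγ, mul_div_cancel₀ _ hF0.ne']
        exact branchWeight_le s t
      · have h1 : F ^ n * γ ^ M ≤ q ^ n := by
          rw [hq, mul_pow, ← NNReal.rpow_mul_natCast]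
          gcongr
          rw [← NNReal.rpow_natCast]
          exact NNReal.rpow_le_rpow_of_exponent_ge hγ0 hγ1 (Finset.mem_filter.1 hM).2
        rw [mul_assoc _ ((F : ℝ≥0∞) ^ n)]
        gcongr
        exact_mod_cast h1
    calc _ ≤ _ := h.mono hsub
      _ ≤ ∑ M ∈ P,
          h {x | x ∈ Ioc (0 : ℝ) 1 ∧ HasRuns x K M n ∧ lurothT^[n] x ∈ Ioc (0 : ℝ) 1} :=
        measure_biUnion_finset_le _ _
      _ ≤ _ := Finset.sum_le_sum hP
      _ ≤ ((n : ℝ≥0∞) + 1) *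
          ((((n : ℝ≥0∞) + 1) ^ 2 * (γ⁻¹ : ℝ≥0)) ^ K * (q : ℝ≥0∞) ^ n * h (Ioc 0 1)) := by
        rw [Finset.sum_const, nsmul_eq_mul]
        gcongr
        have : P.card ≤ n + 1 := (Finset.card_filter_le _ _).trans (by simp)
        exact_mod_cast this
      _ = _ := by push_cast; rw [mul_pow, ← pow_mul, pow_succ]; ring
  have hfin : ∑' n, h (V n) ≠ ∞ := by
    refine ne_top_of_le_ne_top ?_ (ENNReal.tsum_le_tsum hV)
    rw [ENNReal.tsum_mul_right]
    exact ENNReal.mul_ne_top (ENNReal.tsum_coe_ne_top_iff_summable.2 hsumq)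
      (ENNReal.mul_ne_top (ENNReal.pow_ne_top ENNReal.coe_ne_top) (pre_Ioc_ne_top s hr))
  have hz := measure_setOfPred_frequently_eq_zero (μ := h) (p := fun n x => x ∈ V n) hfin
  refine measure_mono_null (fun x hx => ?_) hz
  obtain ⟨hx, hfr⟩ := hE x hx
  exact hfr.mono fun n hn => ⟨hx, hn⟩

end Dimension

theorem isRun_iff {x : ℝ} {j k : ℕ} :
    IsRun x j k ↔ ∀ i : ℕ, 1 ≤ i → i ≤ k → lurothD (j + i) x = lurothD (j + 1) x := by
  refine ⟨fun h i h1 h2 => ?_, fun h i hi => h (i + 1) (by omega) (by omega)⟩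
  have := h (i - 1) (by omega)
  rwa [show j + (i - 1) + 1 = j + i by omega] at this

theorem bddAbove_runs (n : ℕ) (x : ℝ) : BddAbove {k : ℕ | 1 ≤ k ∧ ∃ j : ℕ, j + k ≤ n ∧
    ∀ i : ℕ, 1 ≤ i → i ≤ k → lurothD (j + i) x = lurothD (j + 1) x} :=
  ⟨n, fun _ ⟨_, _, h, _⟩ => by omega⟩

theorem IsRun.le_runLen {x : ℝ} {j k n : ℕ} (h : IsRun x j k) (hk : 1 ≤ k) (hn : j + k ≤ n) :
    k ≤ runLen n x :=
  le_csSup (bddAbove_runs n x) ⟨hk, j, hn, isRun_iff.1 h⟩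

theorem exists_isRun_runLen (x : ℝ) {n : ℕ} (hn : 1 ≤ n) :
    1 ≤ runLen n x ∧ ∃ j, j + runLen n x ≤ n ∧ IsRun x j (runLen n x) := by
  have hne : {k : ℕ | 1 ≤ k ∧ ∃ j : ℕ, j + k ≤ n ∧
      ∀ i : ℕ, 1 ≤ i → i ≤ k → lurothD (j + i) x = lurothD (j + 1) x}.Nonempty :=
    ⟨1, le_rfl, 0, by omega, fun i h1 h2 => by rw [le_antisymm h2 h1]⟩
  obtain ⟨h1, j, h2, h3⟩ := Nat.sSup_mem hne (bddAbove_runs n x)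
  exact ⟨h1, j, h2, isRun_iff.2 h3⟩

theorem runLen_le (n : ℕ) (x : ℝ) : runLen n x ≤ n := by
  rcases Nat.eq_zero_or_pos n with rfl | hn
  · exact csSup_le' fun k hk => by obtain ⟨-, j, h, -⟩ := hk; omega
  · obtain ⟨-, j, h, -⟩ := exists_isRun_runLen x hn
    omega

/-- No run of equal digits of `x` extends across the end of position `n`. -/
def IsBreak (x : ℝ) (n : ℕ) : Prop :=
  n = 0 ∨ lurothD n x ≠ lurothD (n + 1) x

theorem IsRun.isBreak {x : ℝ} {j n : ℕ} (h : IsRun x j (runLen n x)) (hn : j + runLen n x ≤ n) :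
    IsBreak x j := by
  rw [IsBreak, or_iff_not_imp_left]
  intro hj he
  obtain ⟨i, rfl⟩ := Nat.exists_eq_succ_of_ne_zero hj
  have h1 : IsRun x i (runLen n x + 1) := by
    intro l hl
    rcases Nat.eq_zero_or_pos l with rfl | hl0
    · rfl
    · have := h (l - 1) (by omega)
      rw [show i.succ + (l - 1) + 1 = i + l + 1 by omega] at this
      exact this.trans he.symm
  have := h1.le_runLen (by omega) (by omega : i + (runLen n x + 1) ≤ n)
  omega

theorem IsBreak.exists_isRun {x : ℝ} {n T : ℕ} (hn : IsBreak x n) (hT1 : 1 ≤ T)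
    (hT : T < n + runLen T x) :
    ∃ j, j + runLen T x ≤ n ∧ 1 ≤ runLen T x ∧ IsRun x j (runLen T x) ∧ IsBreak x j := by
  obtain ⟨h1, j, hj, hr⟩ := exists_isRun_runLen x hT1
  refine ⟨j, ?_, h1, hr, hr.isBreak hj⟩
  by_contra hlt
  rcases hn with rfl | hn
  · omega
  · refine hn ?_
    have h2 := hr (n - 1 - j) (by omega)
    have h3 := hr (n - j) (by omega)
    rw [show j + (n - 1 - j) + 1 = n by omega] at h2
    rw [show j + (n - j) + 1 = n + 1 by omega] at h3
    rw [h2, h3]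

section Chain

variable {x : ℝ} {a b α' : ℝ}

theorem eventually_hasRuns_sum (ha : 0 < a) (haα : a * (1 - α') < α') (hb0 : 0 < b) (hb1 : b < 1)
    (hlow : ∀ᶠ n : ℕ in atTop, α' * n ≤ runLen n x) (hup : ∀ᶠ n : ℕ in atTop, runLen n x ≤ b * n)
    (K : ℕ) :
    ∀ᶠ n : ℕ in atTop, IsBreak x n → ∃ M : ℕ,
      a * (∑ i ∈ Finset.range K, (a * ((1 - b) / b)) ^ i) * n ≤ M ∧ HasRuns x K M n := by
  induction K with
  | zero => exact Eventually.of_forall fun n _ => ⟨0, by simp, rfl⟩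
  | succ K ih =>
    set q := (1 - b) / b with hq
    have hq0 : 0 < q := div_pos (by linarith) hb0
    set c := a * ∑ i ∈ Finset.range K, (a * q) ^ i with hc
    have hc0 : 0 ≤ c := by positivity
    have hsucc : a * ∑ i ∈ Finset.range (K + 1), (a * q) ^ i = a + a * q * c := by
      rw [Finset.sum_range_succ', hc]
      simp only [pow_succ, ← Finset.sum_mul]
      ring
    rw [hsucc]
    obtain ⟨N₁, hN₁⟩ := eventually_atTop.1 ih
    obtain ⟨N₂, hN₂⟩ := eventually_atTop.1 hlow
    obtain ⟨N₃, hN₃⟩ := eventually_atTop.1 hup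
    have hδ : 0 < α' * (1 + a) - a := by linarith
    have hα' : 0 < α' := by
      by_contra hcon
      nlinarith
    have hcast : Tendsto (fun n : ℕ => (n : ℝ)) atTop atTop := tendsto_natCast_atTop_atTop
    filter_upwards [eventually_ge_atTop N₂, eventually_ge_atTop 1,
      (hcast.const_mul_atTop hδ).eventually_ge_atTop 1,
      (hcast.const_mul_atTop ha).eventually_ge_atTop (N₃ : ℝ),
      (hcast.const_mul_atTop (mul_pos hq0 ha)).eventually_ge_atTop (N₁ : ℝ)]
      with n hn2 hn1 hnδ hn3 hn4 hbr
    obtain ⟨T, hT1, hT2⟩ : ∃ T : ℕ, (1 + a) * n ≤ T ∧ (T : ℝ) < (1 + a) * n + 1 :=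
      ⟨⌈(1 + a) * n⌉₊, Nat.le_ceil _, Nat.ceil_lt_add_one (by positivity)⟩
    have hnT : n ≤ T := by
      have : (n : ℝ) ≤ T := by nlinarith [(Nat.cast_nonneg n : (0 : ℝ) ≤ n)]
      exact_mod_cast this
    have hL := hN₂ T (hn2.trans hnT)
    have hLa : a * n + 1 ≤ runLen T x := by nlinarith
    obtain ⟨j, hj, hL1, hrun, hbrj⟩ := hbr.exists_isRun (hn1.trans hnT) (by
      have : (T : ℝ) < n + runLen T x := by linarith
      exact_mod_cast this)
    have hLN : N₃ ≤ runLen T x := by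
      have : (N₃ : ℝ) ≤ runLen T x := by linarith
      exact_mod_cast this
    have hm := hN₃ (j + runLen T x) (by omega)
    have hm' : (runLen T x : ℝ) ≤ runLen (j + runLen T x) x := by
      exact_mod_cast hrun.le_runLen hL1 le_rfl
    have hjq : q * runLen T x ≤ j := by
      rw [hq, div_mul_eq_mul_div, div_le_iff₀ hb0]
      push_cast at hm
      linarith
    have hjN : N₁ ≤ j := by
      have : (N₁ : ℝ) ≤ j := by nlinarith
      exact_mod_cast this
    obtain ⟨M, hM, hR⟩ := hN₁ j hjN hbrj
    refine ⟨M + runLen T x, ?_, j, _, M, rfl, hL1, hj, hrun, hR⟩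
    push_cast
    have h1 : c * (q * (a * n)) ≤ c * j := by
      refine mul_le_mul_of_nonneg_left (le_trans ?_ hjq) hc0
      exact mul_le_mul_of_nonneg_left (by linarith) hq0.le
    linarith

end Chain

section Level

open scoped Topology

variable {α β : ℝ}

theorem exists_forall_eventually_hasRuns (hα0 : 0 < α) (hαβ : α < β) (hβ1 : β < 1)
    {c : ℝ} (hc : c < α * β / (β - α)) :
    ∃ K, ∀ x, (∀ a < α, ∀ᶠ n : ℕ in atTop, a * n ≤ runLen n x) →
      (∀ b > β, ∀ᶠ n : ℕ in atTop, runLen n x ≤ b * n) →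
      ∀ᶠ n : ℕ in atTop, IsBreak x n → ∃ M : ℕ, c * n ≤ M ∧ HasRuns x K M n := by
  have hβ0 : 0 < β := hα0.trans hαβ
  have hα1 : 0 < 1 - α := by linarith
  have hβα : 0 < β - α := by linarith
  let a : ℝ → ℝ := fun ε => (α - ε) / (1 - (α - ε)) - ε
  let r : ℝ → ℝ := fun ε => a ε * ((1 - (β + ε)) / (β + ε))
  have ha0 : a 0 = α / (1 - α) := by simp [a]
  have hr0 : 1 - r 0 = (β - α) / ((1 - α) * β) := by
    simp only [r, ha0, add_zero]
    field_simp
    ring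
  have hca : ContinuousAt a 0 := by
    refine ContinuousAt.sub (ContinuousAt.div (by fun_prop) (by fun_prop) ?_) continuousAt_id
    simpa using hα1.ne'
  have hcr : ContinuousAt r 0 := by
    refine hca.mul (ContinuousAt.div (by fun_prop) (by fun_prop) ?_)
    simpa using hβ0.ne'
  have hr1 : 0 < 1 - r 0 := by rw [hr0]; positivity
  have hcf : ContinuousAt (fun ε => a ε * (1 - r ε)⁻¹) 0 :=
    hca.mul ((continuousAt_const.sub hcr).inv₀ hr1.ne')
  have hf0 : a 0 * (1 - r 0)⁻¹ = α * β / (β - α) := by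
    rw [hr0, ha0]
    field_simp
  have e1 : ∀ᶠ ε in 𝓝 (0 : ℝ), 0 < a ε :=
    hca.eventually_const_lt (by rw [ha0]; positivity)
  have e2 : ∀ᶠ ε in 𝓝 (0 : ℝ), r ε < 1 := hcr.eventually_lt_const (by linarith)
  have e3 : ∀ᶠ ε in 𝓝 (0 : ℝ), c < a ε * (1 - r ε)⁻¹ :=
    hcf.eventually_const_lt (hc.trans_eq hf0.symm)
  have e4 : ∀ᶠ ε in 𝓝 (0 : ℝ), ε < 1 - β := eventually_lt_nhds (by linarith)
  obtain ⟨ε, ⟨h1, h2, h3, h4⟩, hε⟩ := (((e1.and (e2.and (e3.and e4))).filter_mono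
    nhdsWithin_le_nhds).and self_mem_nhdsWithin : ∀ᶠ ε in 𝓝[>] (0 : ℝ), _).exists
  replace hε : 0 < ε := hε
  have hr0' : 0 ≤ r ε :=
    mul_nonneg h1.le (div_nonneg (by linarith) (by linarith))
  have hlim : Tendsto (fun K => a ε * ∑ i ∈ Finset.range K, r ε ^ i) atTop
      (𝓝 (a ε * (1 - r ε)⁻¹)) :=
    (hasSum_geometric_of_lt_one hr0' h2).tendsto_sum_nat.const_mul _
  obtain ⟨K, hK⟩ := (hlim.eventually_const_lt h3).exists
  refine ⟨K, fun x hlow hup => ?_⟩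
  have haα : a ε * (1 - (α - ε)) < α - ε := by
    have h5 : 0 < 1 - (α - ε) := by linarith
    have : a ε * (1 - (α - ε)) = (α - ε) - ε * (1 - (α - ε)) := by
      simp only [a]
      rw [sub_mul, div_mul_cancel₀ _ h5.ne']
    rw [this]
    have := mul_pos hε h5
    linarith
  filter_upwards [eventually_hasRuns_sum h1 haα (by linarith : 0 < β + ε) (by linarith)
    (hlow _ (by linarith)) (hup _ (by linarith)) K] with n hn hbr
  obtain ⟨M, hM, hR⟩ := hn hbr
  exact ⟨M, le_trans (mul_le_mul_of_nonneg_right hK.le (Nat.cast_nonneg n)) hM, hR⟩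

theorem exists_forall_frequently_hasRuns (hα0 : 0 < α) (hαβ : α < β / (1 + β)) (hβ0 : 0 < β)
    (hβ1 : β < 1) {θ : ℝ} (hθ : θ < β ^ 2 * (1 - α) / (β - α)) :
    ∃ K, ∀ x, (∀ a < α, ∀ᶠ n : ℕ in atTop, a * n ≤ runLen n x) →
      (∀ b > β, ∀ᶠ n : ℕ in atTop, runLen n x ≤ b * n) →
      (∀ b < β, ∃ᶠ n : ℕ in atTop, b * n ≤ runLen n x) →
      ∃ᶠ n : ℕ in atTop, ∃ M : ℕ, θ * n ≤ M ∧ HasRuns x K M n := by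
  rw [lt_div_iff₀ (by linarith)] at hαβ
  have hαβ' : α < β := by nlinarith
  have hβα : 0 < β - α := by linarith
  have h0 : α * β / (β - α) + (1 - α * β / (β - α)) * β = β ^ 2 * (1 - α) / (β - α) := by
    field_simp
    ring
  have hc1 : α * β / (β - α) < 1 := by
    rw [div_lt_one hβα]
    linarith
  have hcont : ContinuousAt
      (fun ε : ℝ => (α * β / (β - α) - ε) + (1 - (α * β / (β - α) - ε)) * (β - ε)) 0 := by
    fun_prop
  have e1 := hcont.eventually_const_lt (u := θ) (by simpa [h0] using hθ)
  have e2 : ∀ᶠ ε in 𝓝 (0 : ℝ), ε < β := eventually_lt_nhds hβ0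
  obtain ⟨ε, ⟨h1, h2⟩, hε⟩ := (((e1.and e2).filter_mono
    nhdsWithin_le_nhds).and self_mem_nhdsWithin : ∀ᶠ ε in 𝓝[>] (0 : ℝ), _).exists
  replace hε : 0 < ε := hε
  set c := α * β / (β - α) - ε with hc
  obtain ⟨K, hK⟩ := exists_forall_eventually_hasRuns hα0 hαβ' hβ1 (c := c) (by linarith)
  refine ⟨K + 1, fun x hlow hup hfr => ?_⟩
  obtain ⟨N₁, hN₁⟩ := eventually_atTop.1 (hK x hlow hup)
  obtain ⟨b, hb, hb1⟩ := exists_between hβ1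
  obtain ⟨N₂, hN₂⟩ := eventually_atTop.1 (hup b hb)
  have hb0 : 0 < b := by linarith
  have hβε : 0 < β - ε := by linarith
  rw [frequently_atTop]
  intro N
  have hcast : Tendsto (fun n : ℕ => (n : ℝ)) atTop atTop := tendsto_natCast_atTop_atTop
  have hq0 : 0 < 1 - b := by linarith
  obtain ⟨n, hn, hn1, hn2, hn3, hn4⟩ := ((hfr (β - ε) (by linarith)).and_eventually
    ((eventually_ge_atTop 1).and (((hcast.const_mul_atTop hβε).eventually_ge_atTop (N : ℝ)).and
    (((hcast.const_mul_atTop hβε).eventually_ge_atTop (N₂ : ℝ)).and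
    ((hcast.const_mul_atTop (mul_pos hq0 hβε)).eventually_ge_atTop (b * N₁)))))).exists
  obtain ⟨hL1, j, hj, hrun⟩ := exists_isRun_runLen x hn1
  set L := runLen n x
  have hNL : N ≤ L := by exact_mod_cast hn2.trans hn
  have hNL2 : N₂ ≤ L := by exact_mod_cast hn3.trans hn
  have hm := hN₂ (j + L) (by omega)
  have hm' : (L : ℝ) ≤ runLen (j + L) x := by exact_mod_cast hrun.le_runLen hL1 le_rfl
  push_cast at hm
  have hjN : N₁ ≤ j := by
    have h5 : b * N₁ ≤ b * (j : ℝ) := by nlinarith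
    exact_mod_cast le_of_mul_le_mul_left h5 hb0
  obtain ⟨M, hM, hR⟩ := hN₁ j hjN (hrun.isBreak hj)
  refine ⟨j + L, by omega, M + L, ?_, j, L, M, rfl, hL1, le_rfl, hrun, hR⟩
  have hjL : ((j : ℝ) + L) ≤ n := by exact_mod_cast hj
  have h6 : (β - ε) * (j + L) ≤ L := (mul_le_mul_of_nonneg_left hjL hβε.le).trans hn
  have h7 : (1 - c) * ((β - ε) * (j + L)) ≤ (1 - c) * L :=
    mul_le_mul_of_nonneg_left h6 (by linarith)
  have h8 : θ * (j + L) ≤ (c + (1 - c) * (β - ε)) * (j + L) :=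
    mul_le_mul_of_nonneg_right h1.le (by positivity)
  push_cast
  linarith

theorem runLen_bounds_of_mem_Eab {x : ℝ} (hx : x ∈ Eab α β) :
    (∀ a < α, ∀ᶠ n : ℕ in atTop, a * n ≤ runLen n x) ∧
      (∀ b > β, ∀ᶠ n : ℕ in atTop, runLen n x ≤ b * n) ∧
      (∀ b < β, ∃ᶠ n : ℕ in atTop, b * n ≤ runLen n x) := by
  obtain ⟨-, hinf, hsup⟩ := hx
  have h0 : ∀ n : ℕ, 0 ≤ (runLen n x : ℝ) / n := fun n => by positivity
  have h1 : ∀ n : ℕ, (runLen n x : ℝ) / n ≤ 1 := fun n =>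
    div_le_one_of_le₀ (by exact_mod_cast runLen_le n x) (Nat.cast_nonneg n)
  have hbb := isBoundedUnder_of_eventually_ge (f := atTop) (Eventually.of_forall h0)
  have hba := isBoundedUnder_of_eventually_le (f := atTop) (Eventually.of_forall h1)
  have hpos : ∀ᶠ n : ℕ in atTop, (0 : ℝ) < n :=
    (eventually_ge_atTop 1).mono fun n hn => by exact_mod_cast hn
  refine ⟨fun a ha => ?_, fun b hb => ?_, fun b hb => ?_⟩
  · filter_upwards [eventually_lt_of_lt_liminf (hinf.symm ▸ ha) hbb, hpos] with n hn hn0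
    exact ((lt_div_iff₀ hn0).1 hn).le
  · filter_upwards [eventually_lt_of_limsup_lt (hsup.symm ▸ hb) hba, hpos] with n hn hn0
    exact ((div_lt_iff₀ hn0).1 hn).le
  · have := frequently_lt_of_lt_limsup hbb.isCoboundedUnder_flip (hsup.symm ▸ hb)
    refine (this.and_eventually hpos).mono fun n hn => ((lt_div_iff₀ hn.2).1 hn.1).le

end Level

open scoped NNReal in
theorem branchWeight_tsum_lt {u σ : ℝ} (hu : 0 ≤ u) (h : lurothF u σ = 1) {s : ℝ≥0}
    (hs : σ < s) :
    Summable (branchWeight s) ∧ ∑' t, branchWeight s t < (2 : ℝ≥0) ^ (u * s) := by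
  have h2u : (1 : ℝ) ≤ 2 ^ u := Real.one_le_rpow one_le_two hu
  have hbase : ∀ t : ℕ, 0 < 1 / ((2 : ℝ) ^ u * ((t : ℝ) + 2) * ((t : ℝ) + 1)) ∧
      1 / ((2 : ℝ) ^ u * ((t : ℝ) + 2) * ((t : ℝ) + 1)) < 1 := fun t => by
    refine ⟨by positivity, ?_⟩
    rw [div_lt_one (by positivity)]
    have ht : (0 : ℝ) ≤ t := Nat.cast_nonneg t
    nlinarith [mul_nonneg (by positivity : (0 : ℝ) ≤ 2 ^ u) ht]
  have hlt : ∀ t : ℕ, (1 / ((2 : ℝ) ^ u * ((t : ℝ) + 2) * ((t : ℝ) + 1))) ^ (s : ℝ) <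
      (1 / ((2 : ℝ) ^ u * ((t : ℝ) + 2) * ((t : ℝ) + 1))) ^ σ := fun t =>
    Real.rpow_lt_rpow_of_exponent_gt (hbase t).1 (hbase t).2 hs
  have hnn : ∀ t : ℕ, 0 ≤ (1 / ((2 : ℝ) ^ u * ((t : ℝ) + 2) * ((t : ℝ) + 1))) ^ (s : ℝ) :=
    fun t => Real.rpow_nonneg (hbase t).1.le _
  have hsumσ : Summable fun t : ℕ =>
      (1 / ((2 : ℝ) ^ u * ((t : ℝ) + 2) * ((t : ℝ) + 1))) ^ σ := by
    by_contra hns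
    rw [lurothF, tsum_eq_zero_of_not_summable hns] at h
    exact zero_ne_one h
  have hsums := hsumσ.of_nonneg_of_le hnn fun t => (hlt t).le
  have hsum_lt := Summable.tsum_lt_tsum (fun t => (hlt t).le) (hlt 0) hsums hsumσ
  rw [show ∑' t : ℕ, (1 / ((2 : ℝ) ^ u * ((t : ℝ) + 2) * ((t : ℝ) + 1))) ^ σ = 1 from h] at hsum_lt
  have hterm : ∀ t : ℕ, (1 / ((2 : ℝ) ^ u * ((t : ℝ) + 2) * ((t : ℝ) + 1))) ^ (s : ℝ) =
      ((2 : ℝ) ^ (u * s))⁻¹ * branchWeight s t := fun t => by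
    have ht : (0 : ℝ) ≤ ((t : ℝ) + 2)⁻¹ * ((t : ℝ) + 1)⁻¹ := by positivity
    have : (1 / ((2 : ℝ) ^ u * ((t : ℝ) + 2) * ((t : ℝ) + 1))) =
        ((2 : ℝ) ^ u)⁻¹ * (((t : ℝ) + 2)⁻¹ * ((t : ℝ) + 1)⁻¹) := by
      rw [one_div, mul_inv, mul_inv, mul_assoc]
    rw [this, Real.mul_rpow (by positivity) ht, Real.inv_rpow (by positivity),
      ← Real.rpow_mul zero_le_two, branchWeight]
    push_cast
    rfl
  have h2 : (0 : ℝ) < 2 ^ (u * s) := by positivity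
  simp only [hterm] at hsums hsum_lt
  have hsummable := (summable_mul_left_iff (inv_ne_zero h2.ne')).1 hsums
  refine ⟨NNReal.summable_coe.1 hsummable, ?_⟩
  rw [tsum_mul_left, inv_mul_lt_iff₀ h2, mul_one] at hsum_lt
  rw [← NNReal.coe_lt_coe, NNReal.coe_tsum]
  simpa using hsum_lt

open scoped NNReal in
theorem mul_div_rpow_lt_one {F ρ : ℝ≥0} {s u θ : ℝ} (hF0 : 0 < F) (hF : F < 2 ^ (u * s))
    (hρ : ρ = 2⁻¹ ^ s) (hθ : θ < 1) (hu : u * (1 - θ) = θ) : F * (ρ / F) ^ θ < 1 := by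
  have h1 : F * (ρ / F) ^ θ = F ^ (1 - θ) * ρ ^ θ := by
    rw [NNReal.div_rpow, NNReal.rpow_sub hF0.ne', NNReal.rpow_one]
    field_simp
  have hρ0 : 0 < ρ ^ θ := by
    rw [hρ]
    exact NNReal.rpow_pos (NNReal.rpow_pos (by positivity))
  calc F * (ρ / F) ^ θ = F ^ (1 - θ) * ρ ^ θ := h1
    _ < (2 ^ (u * s)) ^ (1 - θ) * ρ ^ θ :=
      mul_lt_mul_of_pos_right (NNReal.rpow_lt_rpow hF (by linarith)) hρ0
    _ = 1 := by
      rw [hρ, NNReal.inv_rpow, NNReal.inv_rpow, ← NNReal.rpow_mul, ← NNReal.rpow_mul,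
        show u * s * (1 - θ) = s * θ by rw [mul_right_comm, hu, mul_comm]]
      exact mul_inv_cancel₀ (NNReal.rpow_pos two_pos).ne'

/-- Upper bound: if 0 < α < β/(1+β) < β < 1, then
    dimH E(α,β) ≤ s(β²(1-α)/((1-β)(β-α(1+β)))). -/
theorem luroth_Eαβ_dimH_upper (S : ℝ → ℝ)
    (hS : ∀ u : ℝ, 0 ≤ u → 1/2 < S u ∧ lurothF u (S u) = 1)
    (α β : ℝ) (hα0 : 0 < α) (h1 : α < β / (1 + β)) (h2 : β / (1 + β) < β) (hβ1 : β < 1) :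
    dimH (Eab α β) ≤
      ENNReal.ofReal (S (β ^ 2 * (1 - α) / ((1 - β) * (β - α * (1 + β))))) := by
  have hβ0 : 0 < β := (hα0.trans h1).trans h2
  have hβα : 0 < β - α := by linarith
  have hd : 0 < β - α * (1 + β) := by
    have := (lt_div_iff₀ (by linarith : 0 < 1 + β)).1 h1
    linarith
  have h1α : 0 < 1 - α := by linarith
  have h1β : 0 < 1 - β := by linarith
  set u := β ^ 2 * (1 - α) / ((1 - β) * (β - α * (1 + β))) with hu
  have hu0 : 0 ≤ u := by positivity
  set θ := β ^ 2 * (1 - α) / (β - α) with hθ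
  have h1θ : 1 - θ = (1 - β) * (β - α * (1 + β)) / (β - α) := by
    rw [hθ]
    field_simp
    ring
  have hθ1 : θ < 1 := by
    have : 0 < 1 - θ := by rw [h1θ]; positivity
    linarith
  have huθ : u * (1 - θ) = θ := by
    rw [h1θ, hu, hθ]
    field_simp
  refine le_of_forall_gt_imp_ge_of_dense fun d hd => ?_
  obtain ⟨s, hs, hsd⟩ := ENNReal.lt_iff_exists_nnreal_btwn.1 hd
  refine le_trans ?_ hsd.le
  have hσs : S u < s := by
    rw [ENNReal.ofReal_lt_coe_iff (by linarith [(hS u hu0).1])] at hs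
    exact hs
  obtain ⟨hsum, hF⟩ := branchWeight_tsum_lt hu0 (hS u hu0).2 hσs
  have hg0 := branchWeight_pos s 0
  have hF0 : 0 < ∑' t, branchWeight s t := hg0.trans_le (hsum.le_tsum 0 fun _ _ => zero_le)
  have hlt := mul_div_rpow_lt_one (ρ := branchWeight s 0) hF0 hF (by simp [branchWeight]) hθ1 huθ
  have hcont : ContinuousAt (fun θ : ℝ => (∑' t, branchWeight s t) *
      (branchWeight s 0 / ∑' t, branchWeight s t) ^ θ) θ :=
    continuousAt_const.mul ((NNReal.continuousAt_rpow (Or.inl (div_pos hg0 hF0).ne')).comp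
      (continuousAt_const.prodMk continuousAt_id))
  obtain ⟨θ', hθ', hlt'⟩ := (((hcont.eventually_lt_const hlt).filter_mono
    nhdsWithin_le_nhds).and self_mem_nhdsWithin : ∀ᶠ θ' in nhdsWithin θ (Iio θ), _).exists
  obtain ⟨K, hK⟩ := exists_forall_frequently_hasRuns hα0 h1 hβ0 hβ1 (θ := θ') hlt'
  refine dimH_le_of_frequently_hasRuns (K := K) hsum hθ' fun x hx => ⟨hx.1, ?_⟩
  obtain ⟨hb1, hb2, hb3⟩ := runLen_bounds_of_mem_Eab hx
  exact hK x hb1 hb2 hb3
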